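/- Let h : [0,1] × cl(D) → ℝⁿ be a continuous homotopy with D ⊆ ℝⁿ open and bounded, and let p : [0,1] → ℝⁿ be a continuous path such that p(α) ∉ h(α, ∂D) for all α ∈ [0,1]. If h(0, ·) and h(1, ·) are C¹ and p(0), p(1) are regular values with finite preimage sets, then Σ_{x ∈ h(0,·)⁻¹(p(0))} sign(det J_{h(0,·)}(x)) = Σ_{x ∈ h(1,·)⁻¹(p(1))} sign(det J_{h(1,·)}(x)). -/

import Mathlib

section DegreeHelpers
open MeasureTheory Filter Topology

noncomputable def degVol (n : ℕ) : EuclideanSpace ℝ (Fin n) [⋀^Fin n]→L[ℝ] ℝ :=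
  { (EuclideanSpace.basisFun (Fin n) ℝ).toBasis.det with
    cont := by
      change Continuous (fun v => (EuclideanSpace.basisFun (Fin n) ℝ).toBasis.det v)
      simp only [Module.Basis.det_apply]
      apply Continuous.matrix_det
      refine continuous_pi fun i => continuous_pi fun j => ?_
      simp only [Module.Basis.toMatrix_apply]
      simp
      fun_prop }

theorem degVol_apply {n : ℕ} (A : EuclideanSpace ℝ (Fin n) →L[ℝ] EuclideanSpace ℝ (Fin n)) :
    degVol n (fun i => A (EuclideanSpace.single i 1)) = A.det := by
  have := (EuclideanSpace.basisFun (Fin n) ℝ).toBasis.det_comp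
    (A : EuclideanSpace ℝ (Fin n) →ₗ[ℝ] EuclideanSpace ℝ (Fin n))
    (EuclideanSpace.basisFun (Fin n) ℝ).toBasis
  rw [Module.Basis.det_self, mul_one] at this
  rw [ContinuousLinearMap.det, ← this]
  change (EuclideanSpace.basisFun (Fin n) ℝ).toBasis.det _ = _
  congr 1
  ext i
  simp

/-- the pulled back form -/
noncomputable def degForm {n : ℕ} (φ : EuclideanSpace ℝ (Fin n) → ℝ)
    (F : (Fin (n + 1) → ℝ) → EuclideanSpace ℝ (Fin n)) (z : Fin (n + 1) → ℝ) :
    (Fin (n + 1) → ℝ) [⋀^Fin n]→L[ℝ] ℝ :=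
  (φ (F z) • degVol n).compContinuousLinearMap (fderiv ℝ F z)

theorem degForm_diff {n : ℕ} {φ : EuclideanSpace ℝ (Fin n) → ℝ}
    {F : (Fin (n + 1) → ℝ) → EuclideanSpace ℝ (Fin n)} (hφ : Differentiable ℝ φ)
    (hF : ContDiff ℝ 2 F) : Differentiable ℝ (degForm φ F) := by
  intro z
  have h1 : DifferentiableAt ℝ (fderiv ℝ F) z :=
    ((hF.fderiv_right (m := 1) (by norm_num)).differentiable (by norm_num)) z
  have h2 : DifferentiableAt ℝ F z := (hF.differentiable (by norm_num)) z
  apply DifferentiableAt.continuousAlternatingMapCompContinuousLinearMap _ h1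
  exact ((hφ _).comp z h2).smul_const _

theorem degForm_closed {n : ℕ} {φ : EuclideanSpace ℝ (Fin n) → ℝ}
    {F : (Fin (n + 1) → ℝ) → EuclideanSpace ℝ (Fin n)} (hφ : Differentiable ℝ φ)
    (hF : ContDiff ℝ 2 F) (z : Fin (n + 1) → ℝ) (v : Fin (n + 1) → Fin (n + 1) → ℝ) :
    ∑ i, (-1) ^ i.val • fderiv ℝ (fun z => degForm φ F z (i.removeNth v)) z (v i) = 0 := by
  rw [← extDeriv_apply (degForm_diff hφ hF z)]
  have := extDeriv_pullback (ω := fun y => φ y • degVol n) (f := F) (x := z) (r := 2)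
    ((hφ _).smul_const _) hF.contDiffAt (by simp)
  unfold degForm
  rw [this]
  rw [ContinuousAlternatingMap.compContinuousLinearMap_apply]
  apply AlternatingMap.map_linearDependent (ContinuousAlternatingMap.toAlternatingMap _)
  intro hl
  have := hl.fintype_card_le_finrank
  simp at this

noncomputable def degInt {n : ℕ} (φ : EuclideanSpace ℝ (Fin n) → ℝ)
    (D : Set (EuclideanSpace ℝ (Fin n)))
    (f : EuclideanSpace ℝ (Fin n) → EuclideanSpace ℝ (Fin n)) : ℝ :=
  ∫ x in D, φ (f x) * (fderiv ℝ f x).det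

noncomputable def degL (n : ℕ) : (Fin (n + 1) → ℝ) →L[ℝ] EuclideanSpace ℝ (Fin n) :=
  ((PiLp.continuousLinearEquiv 2 ℝ (fun _ : Fin n => ℝ)).symm :
    (Fin n → ℝ) →L[ℝ] EuclideanSpace ℝ (Fin n)).comp
    (ContinuousLinearMap.pi fun j : Fin n => ContinuousLinearMap.proj (R := ℝ) j.succ)

theorem degL_apply {n : ℕ} (z : Fin (n + 1) → ℝ) (j : Fin n) : degL n z j = z j.succ := rfl

theorem degL_cons {n : ℕ} (t : ℝ) (x : Fin n → ℝ) :
    degL n (Fin.cons t x : Fin (n + 1) → ℝ) = WithLp.toLp 2 x := by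
  ext j; simp [degL_apply]

theorem degL_single {n : ℕ} (j : Fin n) :
    degL n (Pi.single j.succ 1) = EuclideanSpace.single j 1 := by
  ext k; simp [degL_apply, Pi.single_apply]

noncomputable def degF {n : ℕ} (f g : EuclideanSpace ℝ (Fin n) → EuclideanSpace ℝ (Fin n))
    (z : Fin (n + 1) → ℝ) : EuclideanSpace ℝ (Fin n) :=
  f (degL n z) + z 0 • (g (degL n z) - f (degL n z))

theorem degF_contDiff {n : ℕ} {f g : EuclideanSpace ℝ (Fin n) → EuclideanSpace ℝ (Fin n)}
    (hf : ContDiff ℝ 2 f) (hg : ContDiff ℝ 2 g) : ContDiff ℝ 2 (degF f g) := by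
  unfold degF
  have h1 : ContDiff ℝ 2 (degL n) := (degL n).contDiff
  have := hf.comp h1
  have := hg.comp h1
  have h0 : ContDiff ℝ 2 (fun z : Fin (n + 1) → ℝ => z 0) := contDiff_apply _ _ _
  fun_prop

theorem degF_fderiv {n : ℕ} {f g : EuclideanSpace ℝ (Fin n) → EuclideanSpace ℝ (Fin n)}
    (hf : ContDiff ℝ 2 f) (hg : ContDiff ℝ 2 g) (t : ℝ) (x : Fin n → ℝ) (j : Fin n) :
    fderiv ℝ (degF f g) (Fin.cons t x : Fin (n + 1) → ℝ) (Pi.single j.succ 1) =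
      (fderiv ℝ f (WithLp.toLp 2 x) + t • (fderiv ℝ g (WithLp.toLp 2 x) -
        fderiv ℝ f (WithLp.toLp 2 x))) (EuclideanSpace.single j 1) := by
  set z : Fin (n + 1) → ℝ := Fin.cons t x
  have hL : HasFDerivAt (degL n) (degL n) z := (degL n).hasFDerivAt
  have hfz : HasFDerivAt f (fderiv ℝ f (degL n z)) (degL n z) :=
    (hf.differentiable (by norm_num) _).hasFDerivAt
  have hgz : HasFDerivAt g (fderiv ℝ g (degL n z)) (degL n z) :=
    (hg.differentiable (by norm_num) _).hasFDerivAt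
  have h0 : HasFDerivAt (fun z : Fin (n + 1) → ℝ => z 0)
    (ContinuousLinearMap.proj (R := ℝ) (φ := fun _ => ℝ) (0 : Fin (n + 1))) z :=
    hasFDerivAt_apply _ _
  have h1 := hfz.comp z hL
  have h2 := hgz.comp z hL
  have h3 := h1.add (h0.smul (h2.sub h1))
  have h4 : fderiv ℝ (degF f g) z = _ := h3.fderiv
  rw [h4]
  have e1 : degL n z = WithLp.toLp 2 x := degL_cons t x
  have e2 : z 0 = t := rfl
  simp [e1, e2, degL_single]

theorem degInt_eq_pi {n : ℕ} (φ : EuclideanSpace ℝ (Fin n) → ℝ)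
    (D : Set (EuclideanSpace ℝ (Fin n))) (hD : MeasurableSet D)
    (f : EuclideanSpace ℝ (Fin n) → EuclideanSpace ℝ (Fin n)) :
    degInt φ D f = ∫ x : Fin n → ℝ, D.indicator (fun x => φ (f x) * (fderiv ℝ f x).det)
      (WithLp.toLp 2 x) := by
  unfold degInt
  rw [← integral_indicator hD]
  exact ((PiLp.volume_preserving_toLp (Fin n)).integral_comp
    (MeasurableEquiv.toLp 2 (Fin n → ℝ)).measurableEmbedding _).symm

theorem degInt_smooth {n : ℕ} {φ : EuclideanSpace ℝ (Fin n) → ℝ}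
    {D : Set (EuclideanSpace ℝ (Fin n))} (hD : IsOpen D) (hDb : Bornology.IsBounded D)
    {f g : EuclideanSpace ℝ (Fin n) → EuclideanSpace ℝ (Fin n)}
    (hφ : Differentiable ℝ φ) {r : ℝ} (hφr : ∀ y, r < ‖y‖ → φ y = 0)
    (hf : ContDiff ℝ 2 f) (hg : ContDiff ℝ 2 g)
    (hb : ∀ x ∈ frontier D, ∀ t ∈ Set.Icc (0 : ℝ) 1, r < ‖f x + t • (g x - f x)‖) :
    degInt φ D f = degInt φ D g := by
  obtain ⟨R, hR0, hR⟩ := hDb.subset_ball_lt 0 0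
  set F := degF f g with hFdef
  have hF : ContDiff ℝ 2 F := degF_contDiff hf hg
  set e : Fin (n + 1) → Fin (n + 1) → ℝ := fun i => Pi.single i 1 with he
  set V : Fin (n + 1) → (Fin (n + 1) → ℝ) → ℝ := fun i z => degForm φ F z (i.removeNth e) with hV
  have hVd : ∀ i, Differentiable ℝ (V i) := fun i z =>
    (degForm_diff hφ hF z).continuousAlternatingMap_apply_const _
  set S : Set (Fin (n + 1) → ℝ) := degL n ⁻¹' D with hS
  set V' : Fin (n + 1) → (Fin (n + 1) → ℝ) → ℝ := fun i z => S.indicator (V i) z with hV'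
  have hSo : IsOpen S := hD.preimage (degL n).continuous
  have hloc : ∀ z : Fin (n + 1) → ℝ, z 0 ∈ Set.Icc (0 : ℝ) 1 →
      (∀ i, V' i =ᶠ[𝓝 z] V i) ∨ (∀ i, V' i =ᶠ[𝓝 z] fun _ => 0) := by
    intro z hz
    by_cases hzS : z ∈ S
    · left
      intro i
      filter_upwards [hSo.mem_nhds hzS] with w hw
      exact Set.indicator_of_mem hw _
    · right
      intro i
      by_cases hzc : degL n z ∈ closure D
      · have hfr : degL n z ∈ frontier D := by
          rw [hD.frontier_eq]; exact ⟨hzc, hzS⟩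
        have h1 : r < ‖F z‖ := hb _ hfr _ hz
        have h2 : ∀ᶠ w in 𝓝 z, r < ‖F w‖ :=
          (hF.continuous.norm.continuousAt (x := z)).eventually (lt_mem_nhds h1)
        filter_upwards [h2] with w hw
        have : V i w = 0 := by simp [hV, degForm, hφr _ hw]
        exact Set.indicator_apply_eq_zero.2 fun _ => this
      · have : ∀ᶠ w in 𝓝 z, degL n w ∉ closure D :=
          (degL n).continuous.continuousAt.eventually
            (isClosed_closure.isOpen_compl.mem_nhds hzc)
        filter_upwards [this] with w hw
        exact Set.indicator_of_notMem (show w ∉ S from fun h => hw (subset_closure h)) _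
  have hdiff : ∀ z : Fin (n + 1) → ℝ, z 0 ∈ Set.Icc (0 : ℝ) 1 → ∀ i,
      DifferentiableAt ℝ (V' i) z := by
    intro z hz i
    rcases hloc z hz with h | h
    · exact (h i).differentiableAt_iff.2 (hVd i z)
    · exact (h i).differentiableAt_iff.2 (differentiableAt_const _)
  have hdiv : ∀ z : Fin (n + 1) → ℝ, z 0 ∈ Set.Icc (0 : ℝ) 1 →
      ∑ i : Fin (n + 1), ((-1 : ℝ) ^ i.val • fderiv ℝ (V' i) z) (Pi.single i 1) = 0 := by
    intro z hz
    rcases hloc z hz with h | h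
    · rw [← degForm_closed hφ hF z e]
      refine Finset.sum_congr rfl fun i _ => ?_
      rw [(h i).fderiv_eq, zsmul_eq_mul]
      push_cast
      rfl
    · refine Finset.sum_eq_zero fun i _ => ?_
      rw [(h i).fderiv_eq]
      simp
  set a : Fin (n + 1) → ℝ := Fin.cons 0 (fun _ => -R) with ha
  set b : Fin (n + 1) → ℝ := Fin.cons 1 (fun _ => R) with hbd
  have hab : a ≤ b := by
    intro i
    refine Fin.cases ?_ (fun j => ?_) i
    · simp [ha, hbd]
    · simp [ha, hbd]; linarith
  have hz0 : ∀ z ∈ Set.Icc a b, z 0 ∈ Set.Icc (0 : ℝ) 1 := fun z hz => ⟨hz.1 0, hz.2 0⟩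
  have main := integral_divergence_of_hasFDerivAt_off_countable' a b hab
    (fun i z => (-1 : ℝ) ^ i.val • V' i z)
    (fun i z => (-1 : ℝ) ^ i.val • fderiv ℝ (V' i) z) ∅ Set.countable_empty
    (fun i z hz => ((hdiff z (hz0 z hz) i).hasFDerivAt.fun_const_smul _).continuousAt.continuousWithinAt)
    (fun z hz i => by
      have h0 := hz.1 0 trivial
      exact (hdiff z ⟨h0.1.le, h0.2.le⟩ i).hasFDerivAt.fun_const_smul _)
    (by
      refine IntegrableOn.congr_fun (f := fun _ => (0 : ℝ)) integrableOn_zero ?_ measurableSet_Icc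
      intro z hz
      exact (hdiv z (hz0 z hz)).symm)
  rw [setIntegral_congr_fun (g := fun _ => (0 : ℝ)) measurableSet_Icc
    (fun z hz => hdiv z (hz0 z hz)), integral_zero, Fin.sum_univ_succ] at main
  have hbig : ∀ z : Fin (n + 1) → ℝ, ∀ j : Fin n, |z j.succ| = R → ∀ i, V' i z = 0 := by
    intro z j hj i
    refine Set.indicator_of_notMem (fun hz => ?_) _
    have h1 : ‖degL n z‖ < R := by simpa using hR hz
    have h2 := PiLp.norm_apply_le (degL n z) j
    rw [degL_apply, Real.norm_eq_abs, hj] at h2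
    linarith
  rw [Finset.sum_eq_zero (s := Finset.univ) (f := fun j : Fin n => _)] at main
  swap
  · intro j _
    have q : ∀ c : ℝ, |c| = R →
        ∫ x in Set.Icc (a ∘ j.succ.succAbove) (b ∘ j.succ.succAbove),
          (-1 : ℝ) ^ j.succ.val • V' j.succ (j.succ.insertNth c x) = 0 := by
      intro c hc
      rw [← integral_zero (Fin n → ℝ) ℝ]
      congr 1
      ext x
      rw [hbig _ j, smul_zero]
      simpa using hc
    rw [q (b j.succ) (by simp [hbd, abs_of_pos hR0]),
      q (a j.succ) (by simp [ha, abs_of_pos hR0]), sub_zero]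
  have hface : ∀ t : ℝ, ∀ k : EuclideanSpace ℝ (Fin n) → EuclideanSpace ℝ (Fin n),
      (∀ x, f x + t • (g x - f x) = k x) →
      (∀ x, fderiv ℝ f x + t • (fderiv ℝ g x - fderiv ℝ f x) = fderiv ℝ k x) →
      ∫ x in Set.Icc (a ∘ (0 : Fin (n + 1)).succAbove) (b ∘ (0 : Fin (n + 1)).succAbove),
        (-1 : ℝ) ^ (0 : Fin (n + 1)).val • V' 0 ((0 : Fin (n + 1)).insertNth t x)
        = degInt φ D k := by
    intro t k hk hk'
    have hpt : ∀ x : Fin n → ℝ,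
        (-1 : ℝ) ^ (0 : Fin (n + 1)).val • V' 0 ((0 : Fin (n + 1)).insertNth t x) =
        D.indicator (fun x => φ (k x) * (fderiv ℝ k x).det) (WithLp.toLp 2 x) := by
      intro x
      rw [Fin.insertNth_zero']
      have hmem : (Fin.cons t x : Fin (n + 1) → ℝ) ∈ S ↔ WithLp.toLp 2 x ∈ D := by
        rw [hS, Set.mem_preimage, degL_cons]
      by_cases hx : WithLp.toLp 2 x ∈ D
      · rw [Set.indicator_of_mem hx]
        simp only [hV']
        rw [Set.indicator_of_mem (hmem.2 hx)]
        simp only [hV, degForm]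
        rw [ContinuousAlternatingMap.compContinuousLinearMap_apply]
        rw [← degVol_apply, ← hk', ← hk]
        have e1 : F (Fin.cons t x) = f (WithLp.toLp 2 x) + t • (g (WithLp.toLp 2 x) -
          f (WithLp.toLp 2 x)) := by
          rw [hFdef]; unfold degF; rw [degL_cons]; rfl
        rw [e1]
        have e2 : (⇑(fderiv ℝ F (Fin.cons t x)) ∘ (0 : Fin (n + 1)).removeNth e) =
          fun i => (fderiv ℝ f (WithLp.toLp 2 x) + t • (fderiv ℝ g (WithLp.toLp 2 x) -
            fderiv ℝ f (WithLp.toLp 2 x))) (EuclideanSpace.single i 1) := by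
          ext1 j
          rw [← degF_fderiv hf hg]
          rfl
        rw [e2]
        simp
      · rw [Set.indicator_of_notMem hx]
        simp only [hV']
        rw [Set.indicator_of_notMem (fun h => hx (hmem.1 h)), smul_zero]
    simp_rw [hpt]
    rw [degInt_eq_pi φ D hD.measurableSet]
    apply setIntegral_eq_integral_of_forall_compl_eq_zero
    intro x hx
    apply Set.indicator_of_notMem
    intro hxD
    apply hx
    have h1 : ‖WithLp.toLp 2 x‖ < R := by simpa using hR hxD
    have h3 : ∀ j, |x j| ≤ R := fun j => by
      have h2 := PiLp.norm_apply_le (WithLp.toLp 2 x) j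
      rw [Real.norm_eq_abs] at h2
      exact h2.trans h1.le
    constructor
    · intro j; simpa [ha] using (abs_le.1 (h3 j)).1
    · intro j; simpa [hbd] using (abs_le.1 (h3 j)).2
  rw [hface (b 0) g (by intro x; simp [hbd]) (by intro x; simp [hbd]),
    hface (a 0) f (by intro x; simp [ha]) (by
      intro x; ext1 v; simp [ha])] at main
  linarith

theorem deg_approx {n : ℕ} {D : Set (EuclideanSpace ℝ (Fin n))} (hDb : Bornology.IsBounded D)
    {f : EuclideanSpace ℝ (Fin n) → EuclideanSpace ℝ (Fin n)} (hf : ContDiff ℝ 1 f)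
    {ε : ℝ} (hε : 0 < ε) :
    ∃ g : EuclideanSpace ℝ (Fin n) → EuclideanSpace ℝ (Fin n), ContDiff ℝ 2 g ∧
      ∀ x ∈ closure D, ‖g x - f x‖ < ε ∧ ‖fderiv ℝ g x - fderiv ℝ f x‖ < ε := by
  obtain ⟨R, hR0, hR⟩ := hDb.closure.subset_ball_lt 0 0
  let χ : ContDiffBump (0 : EuclideanSpace ℝ (Fin n)) := ⟨R, R + 1, hR0, by linarith⟩
  set u : EuclideanSpace ℝ (Fin n) → EuclideanSpace ℝ (Fin n) := fun x => χ x • f x with hu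
  have huc : ContDiff ℝ 1 u := χ.contDiff.smul hf
  have hus : HasCompactSupport u := χ.hasCompactSupport.smul_right
  have huf : ∀ x ∈ closure D, u =ᶠ[𝓝 x] f := by
    intro x hx
    filter_upwards [Metric.isOpen_ball.mem_nhds (hR hx)] with y hy
    simp only [hu]
    rw [χ.one_of_mem_closedBall (Metric.ball_subset_closedBall hy), one_smul]
  have hud : Continuous (fderiv ℝ u) := huc.continuous_fderiv one_ne_zero
  have huu := hus.uniformContinuous_of_continuous huc.continuous
  have hduu := (hus.fderiv ℝ).uniformContinuous_of_continuous hud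
  obtain ⟨δ1, hδ1, h1⟩ := Metric.uniformContinuous_iff.1 huu (ε / 2) (by linarith)
  obtain ⟨δ2, hδ2, h2⟩ := Metric.uniformContinuous_iff.1 hduu (ε / 2) (by linarith)
  have hδ : 0 < min δ1 δ2 := lt_min hδ1 hδ2
  let ψ : ContDiffBump (0 : EuclideanSpace ℝ (Fin n)) :=
    ⟨min δ1 δ2 / 2, min δ1 δ2, by linarith, by linarith⟩
  set g : EuclideanSpace ℝ (Fin n) → EuclideanSpace ℝ (Fin n) :=
    convolution (ψ.normed volume) u (ContinuousLinearMap.lsmul ℝ ℝ) volume with hg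
  have hgd : ∀ x, fderiv ℝ g x =
      convolution (ψ.normed volume) (fderiv ℝ u) (ContinuousLinearMap.lsmul ℝ ℝ) volume x := by
    intro x
    have := hus.hasFDerivAt_convolution_right (ContinuousLinearMap.lsmul ℝ ℝ)
      (ψ.contDiff_normed (n := 1) (μ := volume)).continuous.locallyIntegrable huc (μ := volume) x
    rw [this.fderiv]
    rfl
  refine ⟨g, ?_, ?_⟩
  · exact ψ.hasCompactSupport_normed.contDiff_convolution_left _ ψ.contDiff_normed
      huc.continuous.locallyIntegrable
  · intro x hx
    constructor
    · rw [← (huf x hx).eq_of_nhds, ← dist_eq_norm]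
      refine (ψ.dist_normed_convolution_le huc.continuous.aestronglyMeasurable (ε := ε / 2)
        fun y hy => (h1 ?_).le).trans_lt (by linarith)
      exact lt_of_lt_of_le hy (min_le_left _ _)
    · rw [← (huf x hx).fderiv_eq, ← dist_eq_norm, hgd]
      refine (ψ.dist_normed_convolution_le hud.aestronglyMeasurable (ε := ε / 2)
        fun y hy => (h2 ?_).le).trans_lt (by linarith)
      exact lt_of_lt_of_le hy (min_le_right _ _)

theorem degInt_tendsto {n : ℕ} {φ : EuclideanSpace ℝ (Fin n) → ℝ}
    {D : Set (EuclideanSpace ℝ (Fin n))} (hD : IsOpen D) (hDb : Bornology.IsBounded D)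
    (hφ : Continuous φ) {r : ℝ} (hφr : ∀ y, r < ‖y‖ → φ y = 0)
    {f : EuclideanSpace ℝ (Fin n) → EuclideanSpace ℝ (Fin n)} (hf : ContDiff ℝ 1 f)
    {u : ℕ → EuclideanSpace ℝ (Fin n) → EuclideanSpace ℝ (Fin n)}
    (hu : ∀ k, ContDiff ℝ 1 (u k))
    (huf : ∀ k : ℕ, ∀ x ∈ closure D, ‖u k x - f x‖ < 1 / ((k : ℝ) + 1) ∧
      ‖fderiv ℝ (u k) x - fderiv ℝ f x‖ < 1 / ((k : ℝ) + 1)) :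
    Tendsto (fun k => degInt φ D (u k)) atTop (𝓝 (degInt φ D f)) := by
  have hcomp : IsCompact (closure D) := hDb.isCompact_closure
  have hdf : Continuous (fderiv ℝ f) := hf.continuous_fderiv one_ne_zero
  obtain ⟨B, hB⟩ := hcomp.exists_bound_of_continuousOn hdf.continuousOn
  have hdet : Continuous (fun A : EuclideanSpace ℝ (Fin n) →L[ℝ] EuclideanSpace ℝ (Fin n) => A.det) :=
    ContinuousLinearMap.continuous_det
  obtain ⟨C, hC⟩ := (isCompact_closedBall
    (0 : EuclideanSpace ℝ (Fin n) →L[ℝ] EuclideanSpace ℝ (Fin n)) (B + 1)).exists_bound_of_continuousOn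
    hdet.continuousOn
  obtain ⟨M, hM⟩ := (isCompact_closedBall
    (0 : EuclideanSpace ℝ (Fin n)) r).exists_bound_of_continuousOn hφ.continuousOn
  have hM' : ∀ y, ‖φ y‖ ≤ max M 0 := by
    intro y
    by_cases hy : r < ‖y‖
    · rw [hφr y hy]; simp
    · exact (hM y (by simpa using hy)).trans (le_max_left _ _)
  have hlim : Tendsto (fun k : ℕ => 1 / ((k : ℝ) + 1)) atTop (𝓝 0) :=
    tendsto_one_div_add_atTop_nhds_zero_nat
  unfold degInt
  refine tendsto_integral_of_dominated_convergence (fun _ => max M 0 * C) ?_ ?_ ?_ ?_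
  · intro k
    have c1 := (hu k).continuous
    have c2 := (hu k).continuous_fderiv one_ne_zero
    exact ((hφ.comp c1).mul (hdet.comp c2)).aestronglyMeasurable
  · have : IsFiniteMeasure (volume.restrict D) := ⟨by
      rw [Measure.restrict_apply_univ]; exact hDb.measure_lt_top⟩
    exact integrable_const _
  · intro k
    refine (ae_restrict_iff' hD.measurableSet).2 (Eventually.of_forall fun x hx => ?_)
    have hx' := subset_closure hx
    rw [norm_mul]
    have h1 : ‖fderiv ℝ (u k) x‖ ≤ B + 1 := by
      have h2 := (huf k x hx').2
      have h3 : 1 / ((k : ℝ) + 1) ≤ 1 := by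
        rw [div_le_one (by positivity)]; linarith [(Nat.cast_nonneg k : (0 : ℝ) ≤ k)]
      have h4 := norm_le_norm_add_norm_sub' (fderiv ℝ (u k) x) (fderiv ℝ f x)
      have h5 := hB x hx'
      linarith
    exact mul_le_mul (hM' _) (hC _ (by simpa using h1)) (norm_nonneg _) (le_max_right _ _)
  · refine (ae_restrict_iff' hD.measurableSet).2 (Eventually.of_forall fun x hx => ?_)
    have hx' := subset_closure hx
    have t1 : Tendsto (fun k => u k x) atTop (𝓝 (f x)) :=
      tendsto_iff_norm_sub_tendsto_zero.2 (squeeze_zero (fun _ => norm_nonneg _)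
        (fun k => (huf k x hx').1.le) hlim)
    have t2 : Tendsto (fun k => fderiv ℝ (u k) x) atTop (𝓝 (fderiv ℝ f x)) :=
      tendsto_iff_norm_sub_tendsto_zero.2 (squeeze_zero (fun _ => norm_nonneg _)
        (fun k => (huf k x hx').2.le) hlim)
    exact ((hφ.tendsto _).comp t1).mul ((hdet.tendsto _).comp t2)

theorem degInt_C1 {n : ℕ} {φ : EuclideanSpace ℝ (Fin n) → ℝ}
    {D : Set (EuclideanSpace ℝ (Fin n))} (hD : IsOpen D) (hDb : Bornology.IsBounded D)
    {f g : EuclideanSpace ℝ (Fin n) → EuclideanSpace ℝ (Fin n)}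
    (hφ : Differentiable ℝ φ) {r : ℝ} (hφr : ∀ y, r < ‖y‖ → φ y = 0)
    (hf : ContDiff ℝ 1 f) (hg : ContDiff ℝ 1 g) {η : ℝ} (hη : 0 < η)
    (hb : ∀ x ∈ frontier D, ∀ t ∈ Set.Icc (0 : ℝ) 1, r + η ≤ ‖f x + t • (g x - f x)‖) :
    degInt φ D f = degInt φ D g := by
  have hpos : ∀ k : ℕ, (0 : ℝ) < 1 / ((k : ℝ) + 1) := fun k => by positivity
  choose u hu huf using fun k : ℕ => deg_approx hDb hf (hpos k)
  choose v hv hvg using fun k : ℕ => deg_approx hDb hg (hpos k)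
  have t1 := degInt_tendsto hD hDb hφ.continuous hφr hf
    (fun k => (hu k).of_le (by norm_num)) huf
  have t2 := degInt_tendsto hD hDb hφ.continuous hφr hg
    (fun k => (hv k).of_le (by norm_num)) hvg
  refine tendsto_nhds_unique_of_eventuallyEq t1 t2 ?_
  have hlim : Tendsto (fun k : ℕ => 1 / ((k : ℝ) + 1)) atTop (𝓝 0) :=
    tendsto_one_div_add_atTop_nhds_zero_nat
  filter_upwards [hlim.eventually (gt_mem_nhds hη)] with k hk
  refine degInt_smooth hD hDb hφ hφr (hu k) (hv k) fun x hx t ht => ?_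
  have hx' : x ∈ closure D := frontier_subset_closure hx
  have h0 := hb x hx t ht
  have h1 := (huf k x hx').1
  have h2 := (hvg k x hx').1
  have e : f x + t • (g x - f x) = (u k x + t • (v k x - u k x)) -
      ((1 - t) • (u k x - f x) + t • (v k x - g x)) := by module
  rw [e] at h0
  have h3 := norm_sub_le (u k x + t • (v k x - u k x))
    ((1 - t) • (u k x - f x) + t • (v k x - g x))
  have h4 := norm_add_le ((1 - t) • (u k x - f x)) (t • (v k x - g x))
  rw [norm_smul, norm_smul, Real.norm_eq_abs, Real.norm_eq_abs, abs_of_nonneg ht.1,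
    abs_of_nonneg (by linarith [ht.2])] at h4
  have h5 : (1 - t) * ‖u k x - f x‖ ≤ (1 - t) * (1 / ((k : ℝ) + 1)) :=
    mul_le_mul_of_nonneg_left h1.le (by linarith [ht.2])
  have h6 : t * ‖v k x - g x‖ ≤ t * (1 / ((k : ℝ) + 1)) :=
    mul_le_mul_of_nonneg_left h2.le ht.1
  linarith

theorem deg_approx_C0 {n : ℕ} {K : Set (EuclideanSpace ℝ (Fin n))} (hK : IsCompact K)
    {f : EuclideanSpace ℝ (Fin n) → EuclideanSpace ℝ (Fin n)} (hf : ContinuousOn f K)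
    {ε : ℝ} (hε : 0 < ε) :
    ∃ g : EuclideanSpace ℝ (Fin n) → EuclideanSpace ℝ (Fin n), ContDiff ℝ 1 g ∧
      ∀ x ∈ K, ‖g x - f x‖ < ε := by
  obtain ⟨G, hG⟩ := ContinuousMap.exists_restrict_eq hK.isClosed
    (⟨K.domRestrict f, hf.domRestrict⟩ : C(K, EuclideanSpace ℝ (Fin n)))
  have hGf : ∀ x ∈ K, G x = f x := fun x hx => by
    have := congrArg (fun u : C(K, EuclideanSpace ℝ (Fin n)) => u ⟨x, hx⟩) hG
    exact this
  have : UniformContinuousOn G (Metric.cthickening 1 K) :=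
    hK.cthickening.uniformContinuousOn_of_continuous G.continuous.continuousOn
  rcases Metric.uniformContinuousOn_iff.mp this (ε / 2) (half_pos hε) with ⟨δ, hδ, hfδ⟩
  rcases (map_continuous G).exists_contDiff_dist_le_of_forall_mem_ball_dist_le
    (lt_min one_pos hδ) with ⟨g, hgc, hg⟩
  refine ⟨g, hgc.of_le (by exact_mod_cast le_top), fun x hx ↦ ?_⟩
  rw [← hGf x hx, ← dist_eq_norm]
  refine (hg _ _ fun y hy ↦ ?_).trans_lt (half_lt_self hε)
  rw [Metric.mem_ball, lt_min_iff] at hy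
  exact hfδ _ (Metric.mem_cthickening_of_dist_le _ x _ _ hx hy.1.le) _
    (Metric.self_subset_cthickening _ hx) hy.2 |>.le

theorem degInt_homotopy {n : ℕ} {φ : EuclideanSpace ℝ (Fin n) → ℝ}
    {D : Set (EuclideanSpace ℝ (Fin n))} (hD : IsOpen D) (hDb : Bornology.IsBounded D)
    {H : ℝ → EuclideanSpace ℝ (Fin n) → EuclideanSpace ℝ (Fin n)}
    (hH : ContinuousOn (fun q : ℝ × EuclideanSpace ℝ (Fin n) => H q.1 q.2)
      (Set.Icc 0 1 ×ˢ closure D))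
    (hφ : Differentiable ℝ φ) {δ : ℝ} (hδ : 0 < δ) (hφr : ∀ y, δ / 4 < ‖y‖ → φ y = 0)
    (hb : ∀ α ∈ Set.Icc (0 : ℝ) 1, ∀ x ∈ frontier D, δ ≤ ‖H α x‖)
    (h0 : ContDiff ℝ 1 (H 0)) (h1 : ContDiff ℝ 1 (H 1)) :
    degInt φ D (H 0) = degInt φ D (H 1) := by
  have hcomp : IsCompact (closure D) := hDb.isCompact_closure
  have huc := (isCompact_Icc.prod hcomp).uniformContinuousOn_of_continuous hH
  obtain ⟨τ, hτ, hun⟩ := Metric.uniformContinuousOn_iff.1 huc (δ / 8) (by linarith)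
  obtain ⟨N, hN⟩ := exists_nat_one_div_lt hτ
  have hN0 : (0 : ℝ) < (N : ℝ) + 1 := by positivity
  have hstep : ∀ α ∈ Set.Icc (0 : ℝ) 1, ∀ g k : EuclideanSpace ℝ (Fin n) →
      EuclideanSpace ℝ (Fin n), ContDiff ℝ 1 g → ContDiff ℝ 1 k →
      (∀ x ∈ frontier D, ‖g x - H α x‖ ≤ δ / 4) → (∀ x ∈ frontier D, ‖k x - H α x‖ ≤ δ / 4) →
      degInt φ D g = degInt φ D k := by
    intro α hα g k hg hk hgH hkH
    refine degInt_C1 hD hDb hφ hφr hg hk (η := δ / 4) (by linarith) fun x hx t ht => ?_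
    have b0 := hb α hα x hx
    have e : H α x = (g x + t • (k x - g x)) -
      ((1 - t) • (g x - H α x) + t • (k x - H α x)) := by module
    rw [e] at b0
    have h3 := norm_sub_le (g x + t • (k x - g x))
      ((1 - t) • (g x - H α x) + t • (k x - H α x))
    have h4 := norm_add_le ((1 - t) • (g x - H α x)) (t • (k x - H α x))
    rw [norm_smul, norm_smul, Real.norm_eq_abs, Real.norm_eq_abs, abs_of_nonneg ht.1,
      abs_of_nonneg (by linarith [ht.2])] at h4
    have h5 : (1 - t) * ‖g x - H α x‖ ≤ (1 - t) * (δ / 4) :=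
      mul_le_mul_of_nonneg_left (hgH x hx) (by linarith [ht.2])
    have h6 : t * ‖k x - H α x‖ ≤ t * (δ / 4) :=
      mul_le_mul_of_nonneg_left (hkH x hx) ht.1
    linarith
  have key : ∀ i : ℕ, i ≤ N + 1 → ∀ g : EuclideanSpace ℝ (Fin n) → EuclideanSpace ℝ (Fin n),
      ContDiff ℝ 1 g → (∀ x ∈ frontier D, ‖g x - H ((i : ℝ) / ((N : ℝ) + 1)) x‖ < δ / 8) →
      degInt φ D (H 0) = degInt φ D g := by
    intro i
    induction i with
    | zero =>
      intro _ g hg hgH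
      simp only [Nat.cast_zero, zero_div] at hgH
      refine hstep 0 (by simp) _ _ h0 hg (fun x _ => ?_) (fun x hx => ?_)
      · simp; linarith
      · linarith [hgH x hx]
    | succ i ih =>
      intro hi g hg hgH
      have hi' : (i : ℝ) + 1 ≤ (N : ℝ) + 1 := by exact_mod_cast hi
      have hα : (i : ℝ) / ((N : ℝ) + 1) ∈ Set.Icc (0 : ℝ) 1 :=
        ⟨by positivity, by rw [div_le_one hN0]; linarith⟩
      have hβ : ((i + 1 : ℕ) : ℝ) / ((N : ℝ) + 1) ∈ Set.Icc (0 : ℝ) 1 :=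
        ⟨by positivity, by rw [div_le_one hN0]; push_cast; linarith⟩
      obtain ⟨k, hk, hkH⟩ := deg_approx_C0 hcomp (f := H ((i : ℝ) / ((N : ℝ) + 1)))
        (hH.comp (f := fun x => ((i : ℝ) / ((N : ℝ) + 1), x)) (by fun_prop)
          (fun x hx => ⟨hα, hx⟩)) (ε := δ / 8) (by linarith)
      rw [ih (by omega) k hk fun x hx => hkH x (frontier_subset_closure hx)]
      refine hstep _ hα _ _ hk hg
        (fun x hx => by linarith [hkH x (frontier_subset_closure hx)]) (fun x hx => ?_)
      have hxc := frontier_subset_closure hx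
      have a1 := hgH x hx
      have a2 := hun (((i + 1 : ℕ) : ℝ) / ((N : ℝ) + 1), x) ⟨hβ, hxc⟩
        ((i : ℝ) / ((N : ℝ) + 1), x) ⟨hα, hxc⟩ (by
          rw [Prod.dist_eq]
          simp only [dist_self]
          rw [Real.dist_eq, ← sub_div]
          push_cast
          rw [add_sub_cancel_left, abs_of_pos (by positivity)]
          exact max_lt hN hτ)
      simp only [dist_eq_norm] at a2
      have a3 := norm_sub_le_norm_sub_add_norm_sub (g x)
        (H (((i + 1 : ℕ) : ℝ) / ((N : ℝ) + 1)) x) (H ((i : ℝ) / ((N : ℝ) + 1)) x)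
      linarith
  refine key (N + 1) le_rfl (H 1) h1 fun x hx => ?_
  have : ((N + 1 : ℕ) : ℝ) / ((N : ℝ) + 1) = 1 := by
    push_cast; exact div_self hN0.ne'
  rw [this]
  simp; linarith

theorem degInt_regular {n : ℕ}
    {D : Set (EuclideanSpace ℝ (Fin n))} (hD : IsOpen D) (hDb : Bornology.IsBounded D)
    {f : EuclideanSpace ℝ (Fin n) → EuclideanSpace ℝ (Fin n)} (hf : ContDiff ℝ 1 f)
    (s : Finset (EuclideanSpace ℝ (Fin n))) (hs : ∀ x, x ∈ s ↔ x ∈ closure D ∧ f x = 0)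
    (hb : ∀ x ∈ frontier D, f x ≠ 0)
    (hreg : ∀ x ∈ s, (fderiv ℝ f x).det ≠ 0) :
    ∃ ρ > 0, ∀ φ : EuclideanSpace ℝ (Fin n) → ℝ, Continuous φ → (∀ y, ρ ≤ ‖y‖ → φ y = 0) →
      ∫ y, φ y = 1 →
      degInt φ D f = ∑ x ∈ s, ((SignType.sign ((fderiv ℝ f x).det) : SignType) : ℝ) := by
  have hcomp : IsCompact (closure D) := hDb.isCompact_closure
  have hdf : Continuous (fderiv ℝ f) := hf.continuous_fderiv one_ne_zero
  have hdet : Continuous (fun x => (fderiv ℝ f x).det) :=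
    ContinuousLinearMap.continuous_det.comp hdf
  have hsD : ∀ x ∈ s, x ∈ D := by
    intro x hx
    by_contra hxD
    have := (hs x).1 hx
    exact hb x (by rw [hD.frontier_eq]; exact ⟨this.1, hxD⟩) this.2
  obtain ⟨U, hU, hUd⟩ := s.finite_toSet.t2_separation
  have hloc : ∀ x ∈ s, ∃ O : Set (EuclideanSpace ℝ (Fin n)), IsOpen O ∧ x ∈ O ∧ O ⊆ U x ∧ O ⊆ D ∧
      Set.InjOn f O ∧ f '' O ∈ 𝓝 0 ∧ ∀ y ∈ O,
        SignType.sign (fderiv ℝ f y).det = SignType.sign (fderiv ℝ f x).det := by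
    intro x hx
    have hx0 : f x = 0 := ((hs x).1 hx).2
    have hstrict := hf.contDiffAt.hasStrictFDerivAt (x := x) one_ne_zero
    let A := (fderiv ℝ f x).toContinuousLinearEquivOfDetNeZero (hreg x hx)
    have hA : HasStrictFDerivAt f (A : EuclideanSpace ℝ (Fin n) →L[ℝ] EuclideanSpace ℝ (Fin n)) x :=
      by simpa only [A, ContinuousLinearMap.coe_toContinuousLinearEquivOfDetNeZero] using hstrict
    have hV : ∃ V : Set (EuclideanSpace ℝ (Fin n)), IsOpen V ∧ x ∈ V ∧ ∀ y ∈ V,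
        SignType.sign (fderiv ℝ f y).det = SignType.sign (fderiv ℝ f x).det := by
      rcases lt_or_gt_of_ne (hreg x hx) with hlt | hgt
      · refine ⟨{y | (fderiv ℝ f y).det < 0}, isOpen_lt hdet continuous_const, hlt, fun y hy => ?_⟩
        rw [sign_neg hlt, sign_neg hy]
      · refine ⟨{y | 0 < (fderiv ℝ f y).det}, isOpen_lt continuous_const hdet, hgt, fun y hy => ?_⟩
        rw [sign_pos hgt, sign_pos hy]
    obtain ⟨V, hVo, hxV, hVs⟩ := hV
    let P := hA.toOpenPartialHomeomorph f
    have hPo : IsOpen P.source := P.open_source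
    have hxP : x ∈ P.source := hA.mem_toOpenPartialHomeomorph_source
    have hPi : Set.InjOn f P.source := P.injOn
    have hWo : IsOpen (P.source ∩ (U x ∩ (D ∩ V))) :=
      hPo.inter ((hU x).2.inter (hD.inter hVo))
    have hxW : x ∈ P.source ∩ (U x ∩ (D ∩ V)) := ⟨hxP, (hU x).1, hsD x hx, hxV⟩
    refine ⟨_, hWo, hxW, fun y hy => hy.2.1, fun y hy => hy.2.2.1,
      hPi.mono fun y hy => hy.1, ?_, fun y hy => hVs y hy.2.2.2⟩
    rw [← hx0, ← hA.map_nhds_eq_of_equiv]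
    exact Filter.image_mem_map (hWo.mem_nhds hxW)
  choose! O hOo hxO hOU hOD hOinj hOim hOsign using hloc
  have hK : IsCompact (closure D \ ⋃ x ∈ s, O x) :=
    hcomp.diff (isOpen_biUnion hOo)
  obtain ⟨ρ0, hρ0, hρK⟩ := hK.exists_forall_le' (f := fun x => ‖f x‖) (a := 0)
    hf.continuous.norm.continuousOn (by
      intro x hx
      rw [norm_pos_iff]
      intro h0
      have hxs := (hs x).2 ⟨hx.1, h0⟩
      exact hx.2 (Set.mem_biUnion hxs (hxO x hxs)))
  have hball : ∃ ρ1 > 0, ∀ x ∈ s, Metric.ball 0 ρ1 ⊆ f '' O x := by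
    have : (⋂ x ∈ s, f '' O x) ∈ 𝓝 (0 : EuclideanSpace ℝ (Fin n)) :=
      (Filter.biInter_finset_mem s).2 hOim
    obtain ⟨ρ1, hρ1, h⟩ := Metric.mem_nhds_iff.1 this
    exact ⟨ρ1, hρ1, fun x hx => h.trans (Set.biInter_subset_of_mem hx)⟩
  obtain ⟨ρ1, hρ1, hρ1'⟩ := hball
  refine ⟨min ρ0 ρ1, lt_min hρ0 hρ1, fun φ hφ hφ0 hφ1 => ?_⟩
  have hcont : Continuous (fun x => φ (f x) * (fderiv ℝ f x).det) :=
    (hφ.comp hf.continuous).mul hdet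
  unfold degInt
  have hsub : (⋃ x ∈ s, O x) ⊆ D := Set.iUnion₂_subset hOD
  rw [setIntegral_eq_of_subset_of_forall_sdiff_eq_zero hD.measurableSet hsub (by
    intro x hx
    rw [hφ0 _ ((min_le_left _ _).trans (hρK x ⟨subset_closure hx.1, hx.2⟩)), zero_mul])]
  rw [integral_biUnion_finset s (fun x hx => (hOo x hx).measurableSet)
    (fun x hx y hy hxy => (hUd hx hy hxy).mono (hOU x hx) (hOU y hy))
    (fun x hx => (hcont.continuousOn.integrableOn_compact hcomp).mono_set
      ((hOD x hx).trans subset_closure))]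
  refine Finset.sum_congr rfl fun x hx => ?_
  have hcv := integral_image_eq_integral_abs_det_fderiv_smul volume (hOo x hx).measurableSet
    (fun y _ => (hf.differentiable one_ne_zero y).hasFDerivAt.hasFDerivWithinAt)
    (hOinj x hx) φ
  rw [setIntegral_eq_integral_of_forall_compl_eq_zero, hφ1] at hcv
  swap
  · intro y hy
    apply hφ0
    by_contra hlt
    push Not at hlt
    exact hy (hρ1' x hx (by simpa using hlt.trans_le (min_le_right _ _)))
  rw [← mul_one ((SignType.sign ((fderiv ℝ f x).det) : SignType) : ℝ), hcv, ← integral_const_mul]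
  refine setIntegral_congr_fun (hOo x hx).measurableSet fun y hy => ?_
  simp only [smul_eq_mul]
  rw [← hOsign x hx y hy, ← mul_assoc, sign_mul_abs, mul_comm]

end DegreeHelpers

open Set
open scoped Classical

/-- Homotopy invariance of the signed count of preimages of a regular value: for a
continuous homotopy `h` on `[0,1] × cl(D)` (`D` open bounded) and a continuous path `p`
with `p(α) ∉ h(α, ∂D)` for all `α`, if `h(0,·)` and `h(1,·)` are C¹ and `p(0)`, `p(1)` are
regular values with finite preimage sets, then the signed counts at times `0` and `1`
coincide. -/
theorem homotopy_invariance_signed_count {n : ℕ} (D : Set (EuclideanSpace ℝ (Fin n)))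
    (hD : IsOpen D) (hDbd : Bornology.IsBounded D)
    (h : ℝ → EuclideanSpace ℝ (Fin n) → EuclideanSpace ℝ (Fin n))
    (hh : ContinuousOn (fun q : ℝ × EuclideanSpace ℝ (Fin n) => h q.1 q.2)
      (Set.Icc 0 1 ×ˢ closure D))
    (p : ℝ → EuclideanSpace ℝ (Fin n)) (hp : ContinuousOn p (Set.Icc 0 1))
    (hbd : ∀ α ∈ Set.Icc (0:ℝ) 1, p α ∉ h α '' frontier D)
    (h0 : ContDiff ℝ 1 (h 0)) (h1 : ContDiff ℝ 1 (h 1))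
    (hreg0 : ∀ x ∈ closure D, h 0 x = p 0 → (fderiv ℝ (h 0) x).det ≠ 0)
    (hreg1 : ∀ x ∈ closure D, h 1 x = p 1 → (fderiv ℝ (h 1) x).det ≠ 0)
    (hfin0 : (closure D ∩ h 0 ⁻¹' {p 0}).Finite)
    (hfin1 : (closure D ∩ h 1 ⁻¹' {p 1}).Finite) :
    (∑ x ∈ hfin0.toFinset, ((SignType.sign ((fderiv ℝ (h 0) x).det) : SignType) : ℤ))
      = ∑ x ∈ hfin1.toFinset, ((SignType.sign ((fderiv ℝ (h 1) x).det) : SignType) : ℤ) := by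
  have hcomp : IsCompact (closure D) := hDbd.isCompact_closure
  have hfc : IsCompact (frontier D) :=
    hcomp.of_isClosed_subset isClosed_frontier frontier_subset_closure
  have hH : ContinuousOn (fun q : ℝ × EuclideanSpace ℝ (Fin n) => h q.1 q.2 - p q.1)
      (Set.Icc 0 1 ×ˢ closure D) :=
    hh.sub (hp.comp continuous_fst.continuousOn fun q hq => hq.1)
  have h01 : (0 : ℝ) ∈ Set.Icc (0 : ℝ) 1 := ⟨le_refl _, zero_le_one⟩
  have h11 : (1 : ℝ) ∈ Set.Icc (0 : ℝ) 1 := ⟨zero_le_one, le_refl _⟩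
  obtain ⟨δ, hδ, hδb⟩ := (isCompact_Icc.prod hfc).exists_forall_le'
    (f := fun q : ℝ × EuclideanSpace ℝ (Fin n) => ‖h q.1 q.2 - p q.1‖) (a := 0)
    (hH.mono (Set.prod_mono (subset_refl _) frontier_subset_closure)).norm (by
      intro q hq
      rw [norm_pos_iff, sub_ne_zero]
      exact fun e => hbd q.1 hq.1 ⟨q.2, hq.2, e⟩)
  have hb : ∀ α ∈ Set.Icc (0 : ℝ) 1, ∀ x ∈ frontier D, δ ≤ ‖h α x - p α‖ :=
    fun α hα x hx => hδb (α, x) ⟨hα, hx⟩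
  have hd : ∀ α x, fderiv ℝ (fun y => h α y - p α) x = fderiv ℝ (h α) x :=
    fun α x => fderiv_sub_const _
  have hne : ∀ α ∈ Set.Icc (0 : ℝ) 1, ∀ x ∈ frontier D, h α x - p α ≠ 0 :=
    fun α hα x hx => norm_pos_iff.1 (hδ.trans_le (hb α hα x hx))
  have hc0 : ContDiff ℝ 1 (fun y => h 0 y - p 0) := h0.sub contDiff_const
  have hc1 : ContDiff ℝ 1 (fun y => h 1 y - p 1) := h1.sub contDiff_const
  obtain ⟨ρ0, hρ0, hR0⟩ := degInt_regular hD hDbd hc0 hfin0.toFinset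
    (fun x => by simp [sub_eq_zero]) (hne 0 h01) (fun x hx => by
      rw [hd]
      have := (Set.Finite.mem_toFinset hfin0).1 hx
      exact hreg0 x this.1 this.2)
  obtain ⟨ρ1, hρ1, hR1⟩ := degInt_regular hD hDbd hc1 hfin1.toFinset
    (fun x => by simp [sub_eq_zero]) (hne 1 h11) (fun x hx => by
      rw [hd]
      have := (Set.Finite.mem_toFinset hfin1).1 hx
      exact hreg1 x this.1 this.2)
  obtain ⟨r, hr, hr0, hr1, hrd⟩ : ∃ r : ℝ, 0 < r ∧ r ≤ ρ0 ∧ r ≤ ρ1 ∧ r ≤ δ / 4 :=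
    ⟨min ρ0 (min ρ1 (δ / 4)), lt_min hρ0 (lt_min hρ1 (by linarith)), min_le_left _ _,
      (min_le_right _ _).trans (min_le_left _ _), (min_le_right _ _).trans (min_le_right _ _)⟩
  let B : ContDiffBump (0 : EuclideanSpace ℝ (Fin n)) := ⟨r / 2, r, by linarith, by linarith⟩
  have hBz : ∀ y, r ≤ ‖y‖ → B.normed MeasureTheory.volume y = 0 := by
    intro y hy
    by_contra hne'
    have : y ∈ Function.support (B.normed MeasureTheory.volume) := hne'
    rw [B.support_normed_eq] at this
    have h3 : ‖y‖ < r := by simpa using this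
    linarith
  have hBc : ContDiff ℝ 1 (B.normed MeasureTheory.volume) := B.contDiff_normed
  have hB1 : ∫ y, B.normed MeasureTheory.volume y = 1 := B.integral_normed
  have e0 := hR0 _ hBc.continuous (fun y hy => hBz y (hr0.trans hy)) hB1
  have e1 := hR1 _ hBc.continuous (fun y hy => hBz y (hr1.trans hy)) hB1
  have e := degInt_homotopy hD hDbd (H := fun α x => h α x - p α) hH
    (hBc.differentiable one_ne_zero) hδ (fun y hy => hBz y (hrd.trans hy.le)) hb hc0 hc1
  have e2 := (e0.symm.trans e).trans e1
  simp only [hd] at e2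
  have hcast : ∀ t : SignType, ((t : ℤ) : ℝ) = (t : ℝ) := by
    intro t
    cases t <;> simp
  apply Int.cast_injective (α := ℝ)
  rw [Int.cast_sum, Int.cast_sum]
  simp only [hcast]
  exact e2
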